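/- arXiv:math-ph/0305025 — 2 statements merged into one kernel-verified Lean document; each statement's English description precedes it below -/
import Mathlib

section
/- Let N_k → ∞ and L_k, g_k > 0 be sequences with N_k g_k L_k → ∞ and g_k L_k (N_k g_k L_k)^{1/(s+1)}/N_k → 0. Then [(N_k/L_k²)(N_k g_k L_k)^{s/(s+1)}]^{−1} E(N_k, L_k, g_k) → E^{TF}(1,1,1), where E^{TF}(1,1,1) = inf{∫_ℝ(|z|^s ρ(z) + ρ(z)²/2)dz : ρ ≥ 0 measurable, ∫ρ = 1}. -/
open MeasureTheory Real Filter Set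
open scoped ENNReal

noncomputable section

/-- The general 1D energy functional `𝓔_{L,g}[ρ] = ∫ (|(√ρ)′|² + V_L ρ + ρ³ e(g/ρ))`
with `V_L(z) = L⁻²|z/L|^s`, written in terms of `φ = √ρ` (so `ρ = φ²`). -/
noncomputable def EEfun (s : ℝ) (e : ℝ → ℝ) (L g : ℝ) (φ : ℝ → ℝ) : ℝ≥0∞ :=
  ∫⁻ z : ℝ, ENNReal.ofReal ((deriv φ z)^2 + L⁻¹^2 * |z / L| ^ s * (φ z)^2
    + (φ z)^6 * e (g / (φ z)^2))

/-- The ground state energy `E(N,L,g)` of the general 1D functional (as an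
extended real), minimized over densities `ρ = φ²` with `∫ρ = N`. -/
noncomputable def EEinf (s : ℝ) (e : ℝ → ℝ) (Nr L g : ℝ) : ℝ≥0∞ :=
  sInf {E | ∃ φ : ℝ → ℝ, ContDiff ℝ 1 φ ∧ (∀ z, 0 ≤ φ z) ∧
    (∫⁻ z : ℝ, ENNReal.ofReal ((φ z)^2)) = ENNReal.ofReal Nr ∧ EEfun s e L g φ = E}

/-- The ground state energy `E(N,L,g)` of the general 1D functional. -/
noncomputable def EEen (s : ℝ) (e : ℝ → ℝ) (Nr L g : ℝ) : ℝ := (EEinf s e Nr L g).toReal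

/-- The Thomas–Fermi energy `E^{TF}(1,1,1) = inf ∫ (|z|^s ρ + ρ²/2)` over
normalized measurable densities. -/
noncomputable def ETF111 (s : ℝ) : ℝ :=
  (sInf {E : ℝ≥0∞ | ∃ ρ : ℝ → ℝ, Measurable ρ ∧ (∀ z, 0 ≤ ρ z) ∧
    (∫⁻ z : ℝ, ENNReal.ofReal (ρ z)) = 1 ∧
    (∫⁻ z : ℝ, ENNReal.ofReal (|z| ^ s * ρ z + (ρ z)^2 / 2)) = E}).toReal

/-- The Thomas–Fermi energy `∫ (|z|^s ρ + ρ²/2)` of a density `ρ`. -/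
noncomputable def TFfun (s : ℝ) (ρ : ℝ → ℝ) : ℝ≥0∞ :=
  ∫⁻ z : ℝ, ENNReal.ofReal (|z| ^ s * ρ z + (ρ z) ^ 2 / 2)

/-- The Thomas–Fermi profile `(κ^s - |z|^s)₊`, supported in `[-κ, κ]`. -/
noncomputable def TFprofile (s κ z : ℝ) : ℝ := max 0 (κ ^ s - |z| ^ s)

theorem continuous_abs_rpow {s : ℝ} (hs : 0 < s) : Continuous fun z : ℝ => |z| ^ s :=
  continuous_abs.rpow_const fun _ => Or.inr hs.le

theorem continuous_TFprofile {s : ℝ} (hs : 0 < s) (κ : ℝ) : Continuous (TFprofile s κ) :=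
  continuous_const.max (continuous_const.sub (continuous_abs_rpow hs))

theorem TFprofile_nonneg (s κ z : ℝ) : 0 ≤ TFprofile s κ z := le_max_left _ _

theorem support_TFprofile_subset {s κ : ℝ} (hs : 0 < s) (hκ : 0 < κ) :
    Function.support (TFprofile s κ) ⊆ Icc (-κ) κ := by
  intro z hz
  by_contra h
  refine hz (max_eq_left (sub_nonpos.2 (rpow_le_rpow hκ.le ?_ hs.le)))
  exact (not_le.1 fun h' => h (abs_le.1 h')).le

theorem integrable_of_support_subset_Icc {f : ℝ → ℝ} (hf : Continuous f) {a b : ℝ}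
    (hsupp : Function.support f ⊆ Icc a b) : Integrable f :=
  hf.integrable_of_hasCompactSupport <|
    HasCompactSupport.of_support_subset_isCompact isCompact_Icc hsupp

/-- A Thomas–Fermi profile of unit mass exists. -/
theorem exists_integral_TFprofile_eq_one {s : ℝ} (hs : 0 < s) :
    ∃ κ : ℝ, 0 < κ ∧ ∫ z, TFprofile s κ z = 1 := by
  have hscale : ∀ κ : ℝ, 0 < κ →
      ∫ z, TFprofile s κ z = κ ^ (s + 1) * ∫ z, TFprofile s 1 z := by
    intro κ hκ
    have h1 := Measure.integral_comp_mul_left (fun z => TFprofile s κ z) κ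
    have h2 : ∀ z, TFprofile s κ (κ * z) = κ ^ s * TFprofile s 1 z := by
      intro z
      have : (0 : ℝ) ≤ κ ^ s := by positivity
      simp only [TFprofile]
      rw [abs_mul, abs_of_pos hκ, mul_rpow hκ.le (abs_nonneg z), one_rpow,
        mul_max_of_nonneg _ _ this]
      ring_nf
    simp only [h2] at h1
    rw [integral_const_mul, abs_of_pos (inv_pos.2 hκ), smul_eq_mul] at h1
    rw [rpow_add_one hκ.ne']
    field_simp at h1
    linarith
  have hpos : 0 < ∫ z, TFprofile s 1 z := by
    refine (integral_pos_iff_support_of_nonneg (TFprofile_nonneg s 1)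
      (integrable_of_support_subset_Icc (continuous_TFprofile hs 1)
        (support_TFprofile_subset hs one_pos))).2 ?_
    refine (continuous_TFprofile hs 1).isOpen_support.measure_pos _ ⟨0, ?_⟩
    simp [TFprofile, zero_rpow hs.ne']
  refine ⟨(∫ z, TFprofile s 1 z)⁻¹ ^ (1 / (s + 1)), by positivity, ?_⟩
  rw [hscale _ (by positivity), ← rpow_mul (by positivity), one_div,
    inv_mul_cancel₀ (by positivity), rpow_one, inv_mul_cancel₀ hpos.ne']

/-- A Thomas–Fermi profile of unit mass minimizes the Thomas–Fermi energy. -/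
theorem TFfun_TFprofile_le {s κ : ℝ} (hs : 0 < s) (hκ : 0 < κ)
    (hint : ∫ z, TFprofile s κ z = 1) {ρ : ℝ → ℝ} (hm : Measurable ρ) (h0 : ∀ z, 0 ≤ ρ z)
    (h1 : ∫⁻ z, ENNReal.ofReal (ρ z) = 1) :
    TFfun s (TFprofile s κ) ≤ TFfun s ρ := by
  have hv := continuous_abs_rpow hs
  have hf := continuous_TFprofile hs κ
  have hf1 : ∫⁻ z, ENNReal.ofReal (TFprofile s κ z) = 1 := by
    rw [← ofReal_integral_eq_lintegral_ofReal (integrable_of_support_subset_Icc hf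
      (support_TFprofile_subset hs hκ)) (Eventually.of_forall (TFprofile_nonneg s κ)), hint,
      ENNReal.ofReal_one]
  have hμ : 0 ≤ κ ^ s := by positivity
  have key : TFfun s (TFprofile s κ) + ENNReal.ofReal (κ ^ s) * 1
      ≤ TFfun s ρ + ENNReal.ofReal (κ ^ s) * 1 := by
    nth_rw 1 [← h1]
    rw [← hf1]
    unfold TFfun
    rw [← lintegral_const_mul _ hm.ennreal_ofReal,
      ← lintegral_const_mul _ hf.measurable.ennreal_ofReal,
      ← lintegral_add_right _ (hm.ennreal_ofReal.const_mul _),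
      ← lintegral_add_right _ (hf.measurable.ennreal_ofReal.const_mul _)]
    refine lintegral_mono fun z => ?_
    have hvz : 0 ≤ |z| ^ s := by positivity
    have hfz := TFprofile_nonneg s κ z
    have hz := h0 z
    rw [← ENNReal.ofReal_mul hμ, ← ENNReal.ofReal_mul hμ, ← ENNReal.ofReal_add (by positivity)
      (by positivity), ← ENNReal.ofReal_add (by positivity) (by positivity)]
    refine ENNReal.ofReal_le_ofReal ?_
    rcases le_total (κ ^ s) (|z| ^ s) with h | h
    · have : TFprofile s κ z = 0 := max_eq_left (sub_nonpos.2 h)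
      rw [this]
      nlinarith
    · have : TFprofile s κ z = κ ^ s - |z| ^ s := max_eq_right (sub_nonneg.2 h)
      rw [this]
      nlinarith [sq_nonneg (ρ z - (κ ^ s - |z| ^ s))]
  exact (ENNReal.add_le_add_iff_right (by simp)).1 key

/-- If continuous functions supported in a common interval converge uniformly, then so do the
integrals of their weighted powers. -/
theorem tendsto_integral_mul_pow {w q : ℝ → ℝ} {h : ℕ → ℝ → ℝ} {R : ℝ} (hw : Continuous w)
    (hq : Continuous q) (hh : ∀ n, Continuous (h n))
    (hsupp : ∀ n, Function.support (h n) ⊆ Icc (-R) R)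
    (hlim : ∀ n z, dist (h n z) (q z) < 1 / ((n : ℝ) + 1)) {p : ℕ} (hp : p ≠ 0) :
    Tendsto (fun n => ∫ z, w z * h n z ^ p) atTop (nhds (∫ z, w z * q z ^ p)) := by
  refine tendsto_integral_of_dominated_convergence
    ((Icc (-R) R).indicator fun z => |w z| * (|q z| + 1) ^ p) ?_ ?_ ?_ ?_
  · exact fun n => (hw.mul ((hh n).pow p)).aestronglyMeasurable
  · exact (Continuous.integrableOn_Icc (by fun_prop)).integrable_indicator measurableSet_Icc
  · refine fun n => Eventually.of_forall fun z => ?_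
    by_cases hz : z ∈ Icc (-R) R
    · rw [indicator_of_mem hz, norm_mul, norm_pow, Real.norm_eq_abs, Real.norm_eq_abs]
      gcongr
      have h1 := hlim n z
      have h2 : 1 / ((n : ℝ) + 1) ≤ 1 := by
        rw [div_le_one (by positivity)]
        linarith [(Nat.cast_nonneg n : (0 : ℝ) ≤ n)]
      rw [Real.dist_eq] at h1
      have := abs_sub_abs_le_abs_sub (h n z) (q z)
      linarith
    · have : h n z = 0 := by
        by_contra hne
        exact hz (hsupp n hne)
      simp [this, hp, indicator_of_notMem hz]
  · refine Eventually.of_forall fun z => ?_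
    refine tendsto_const_nhds.mul (Tendsto.pow ?_ p)
    rw [tendsto_iff_dist_tendsto_zero]
    exact squeeze_zero (fun _ => dist_nonneg) (fun n => (hlim n z).le)
      tendsto_one_div_add_atTop_nhds_zero_nat

theorem TFfun_eq_ofReal {s : ℝ} (hs : 0 < s) {f : ℝ → ℝ} (hf : Continuous f)
    (h0 : ∀ z, 0 ≤ f z) {R : ℝ} (hsupp : Function.support f ⊆ Icc (-R) R) :
    TFfun s f = ENNReal.ofReal ((∫ z, |z| ^ s * f z) + (∫ z, f z ^ 2) / 2) := by
  have hv := continuous_abs_rpow hs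
  have i1 : Integrable fun z => |z| ^ s * f z :=
    integrable_of_support_subset_Icc (hv.mul hf) fun z hz => hsupp (right_ne_zero_of_mul hz)
  have i2 : Integrable fun z => f z ^ 2 / 2 :=
    integrable_of_support_subset_Icc (by fun_prop) fun z hz => hsupp fun h => hz (by simp [h])
  rw [← integral_div, ← integral_add i1 i2]
  refine (ofReal_integral_eq_lintegral_ofReal (i1.add i2) (Eventually.of_forall fun z => ?_)).symm
  have := h0 z
  simp only [Pi.zero_apply, Pi.add_apply]
  positivity

/-- A continuous compactly supported density of unit mass is approximated in Thomas–Fermi energy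
by squares of smooth functions. -/
theorem exists_contDiff_TFfun_le {s : ℝ} (hs : 0 < s) {f : ℝ → ℝ} (hf : Continuous f)
    (h0 : ∀ z, 0 ≤ f z) {R : ℝ} (hsupp : Function.support f ⊆ Icc (-R) R)
    (hint : ∫ z, f z = 1) {η : ℝ} (hη : 0 < η) :
    ∃ ψ : ℝ → ℝ, ContDiff ℝ 1 ψ ∧ (∀ z, 0 ≤ ψ z) ∧
      ∫⁻ z, ENNReal.ofReal (ψ z ^ 2) = 1 ∧ ∫⁻ z, ENNReal.ofReal (deriv ψ z ^ 2) ≠ ⊤ ∧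
      TFfun s (fun z => ψ z ^ 2) ≤ TFfun s f + ENNReal.ofReal η := by
  have hv := continuous_abs_rpow hs
  set q : ℝ → ℝ := fun z => √√(f z) with hq
  have hqc : Continuous q := hf.sqrt.sqrt
  have hq4 : ∀ z, q z ^ 4 = f z := fun z => by
    rw [show q z ^ 4 = (q z ^ 2) ^ 2 by ring, hq]
    simp only
    rw [sq_sqrt (sqrt_nonneg _), sq_sqrt (h0 z)]
  have hex : ∀ n : ℕ, ∃ h : ℝ → ℝ, ContDiff ℝ 1 h ∧
      (∀ z, dist (h z) (q z) < 1 / ((n : ℝ) + 1)) ∧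
      Function.support h ⊆ Function.support q := fun n =>
    hqc.exists_contDiff_approx (ε := fun _ => 1 / ((n : ℝ) + 1)) 1 continuous_const
      fun _ => by positivity
  choose h hcd hlim hsub using hex
  have hhs : ∀ n, Function.support (h n) ⊆ Icc (-R) R := fun n z hz => by
    refine hsupp fun hfz => hsub n hz ?_
    simp [hq, hfz]
  have hhc := fun n => (hcd n).continuous
  have lim_mass := tendsto_integral_mul_pow (w := fun _ => 1) continuous_const hqc hhc hhs hlim
    (p := 4) (by norm_num)
  have lim_pot := tendsto_integral_mul_pow hv hqc hhc hhs hlim (p := 4) (by norm_num)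
  have lim_int := tendsto_integral_mul_pow (w := fun _ => 1) continuous_const hqc hhc hhs hlim
    (p := 8) (by norm_num)
  have hq8 : ∀ z, q z ^ 8 = f z ^ 2 := fun z => by rw [← hq4]; ring
  simp only [one_mul, hq4, hq8, hint] at lim_mass lim_pot lim_int
  set m : ℕ → ℝ := fun n => ∫ z, h n z ^ 4
  have lim_en : Tendsto (fun n => (∫ z, |z| ^ s * h n z ^ 4) / m n + (∫ z, h n z ^ 8) / m n ^ 2 / 2)
      atTop (nhds ((∫ z, |z| ^ s * f z) + (∫ z, f z ^ 2) / 2)) := by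
    have := (lim_pot.div lim_mass one_ne_zero).add
      ((lim_int.div (lim_mass.pow 2) (by norm_num)).div_const 2)
    simpa using this
  obtain ⟨n, hmn, hen⟩ := ((lim_mass.eventually (lt_mem_nhds (a := 0) one_pos)).and
    (lim_en.eventually (gt_mem_nhds (lt_add_of_pos_right _ hη)))).exists
  have hmn : 0 < m n := hmn
  set ψ : ℝ → ℝ := fun z => h n z ^ 2 / √(m n) with hψ
  have hψ2 : ∀ z, ψ z ^ 2 = h n z ^ 4 / m n := fun z => by
    simp only [hψ, div_pow, sq_sqrt hmn.le]
    ring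
  have hψcd : ContDiff ℝ 1 ψ := ((hcd n).pow 2).div_const _
  have hψc2 : Continuous fun z => ψ z ^ 2 := hψcd.continuous.pow 2
  have hψs : Function.support ψ ⊆ Icc (-R) R := fun z hz => hhs n fun h => hz (by simp [hψ, h])
  have hψs2 : Function.support (fun z => ψ z ^ 2) ⊆ Icc (-R) R :=
    fun z hz => hψs fun h => hz (by simp [h])
  refine ⟨ψ, hψcd, fun z => by positivity, ?_, ?_, ?_⟩
  · rw [← ofReal_integral_eq_lintegral_ofReal
      (integrable_of_support_subset_Icc hψc2 hψs2)
      (Eventually.of_forall fun z => sq_nonneg _)]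
    simp only [hψ2]
    rw [integral_div, div_self hmn.ne', ENNReal.ofReal_one]
  · have hc : HasCompactSupport ψ :=
      HasCompactSupport.of_support_subset_isCompact isCompact_Icc hψs
    have hd : Continuous fun z => deriv ψ z ^ 2 := (hψcd.continuous_deriv le_rfl).pow 2
    have hi : Integrable fun z => deriv ψ z ^ 2 := hd.integrable_of_hasCompactSupport <|
      hc.deriv.comp_left (g := fun x : ℝ => x ^ 2) (by norm_num)
    rw [← ofReal_integral_eq_lintegral_ofReal hi (Eventually.of_forall fun z => sq_nonneg _)]
    exact ENNReal.ofReal_ne_top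
  · have hTf : (0 : ℝ) ≤ (∫ z, |z| ^ s * f z) + (∫ z, f z ^ 2) / 2 := by
      have : 0 ≤ ∫ z, |z| ^ s * f z := integral_nonneg fun z => mul_nonneg (by positivity) (h0 z)
      have : 0 ≤ ∫ z, f z ^ 2 := integral_nonneg fun z => sq_nonneg _
      positivity
    rw [TFfun_eq_ofReal hs hψc2 (fun z => sq_nonneg _) hψs2,
      TFfun_eq_ofReal hs hf h0 hsupp, ← ENNReal.ofReal_add hTf hη.le]
    refine ENNReal.ofReal_le_ofReal (le_trans (le_of_eq ?_) hen.le)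
    have e1 : ∀ z, |z| ^ s * ψ z ^ 2 = |z| ^ s * h n z ^ 4 / m n := fun z => by
      rw [hψ2]; ring
    have e2 : ∀ z, (ψ z ^ 2) ^ 2 = h n z ^ 8 / m n ^ 2 := fun z => by
      rw [hψ2]; ring
    simp only [e1, e2]
    rw [integral_div, integral_div]

/-- The Thomas–Fermi energy as an extended real. -/
noncomputable def TFinf (s : ℝ) : ℝ≥0∞ :=
  sInf {E : ℝ≥0∞ | ∃ ρ : ℝ → ℝ, Measurable ρ ∧ (∀ z, 0 ≤ ρ z) ∧
    (∫⁻ z : ℝ, ENNReal.ofReal (ρ z)) = 1 ∧ TFfun s ρ = E}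

theorem ETF111_eq (s : ℝ) : ETF111 s = (TFinf s).toReal := rfl

theorem TFinf_le {s : ℝ} {ψ : ℝ → ℝ} (hψ : Continuous ψ)
    (h1 : ∫⁻ z, ENNReal.ofReal (ψ z ^ 2) = 1) : TFinf s ≤ TFfun s fun z => ψ z ^ 2 :=
  sInf_le ⟨_, (hψ.pow 2).measurable, fun _ => sq_nonneg _, h1, rfl⟩

/-- Smooth trial functions of finite kinetic energy nearly attain the Thomas–Fermi energy. -/
theorem TFinf_ne_top_and_exists_contDiff {s : ℝ} (hs : 0 < s) :
    TFinf s ≠ ⊤ ∧ ∀ η : ℝ, 0 < η → ∃ ψ : ℝ → ℝ, ContDiff ℝ 1 ψ ∧ (∀ z, 0 ≤ ψ z) ∧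
      ∫⁻ z, ENNReal.ofReal (ψ z ^ 2) = 1 ∧ ∫⁻ z, ENNReal.ofReal (deriv ψ z ^ 2) ≠ ⊤ ∧
      TFfun s (fun z => ψ z ^ 2) ≤ TFinf s + ENNReal.ofReal η := by
  obtain ⟨κ, hκ, hint⟩ := exists_integral_TFprofile_eq_one hs
  have hc := continuous_TFprofile hs κ
  have hsupp := support_TFprofile_subset hs hκ
  have hle : TFfun s (TFprofile s κ) ≤ TFinf s := by
    refine le_sInf ?_
    rintro _ ⟨ρ, hm, h0, h1, rfl⟩
    exact TFfun_TFprofile_le hs hκ hint hm h0 h1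
  have happrox := fun η hη =>
    exists_contDiff_TFfun_le (η := η) hs hc (TFprofile_nonneg s κ) hsupp hint hη
  constructor
  · obtain ⟨ψ, hψ, -, h1, -, hE⟩ := happrox 1 one_pos
    refine ne_top_of_le_ne_top ?_ ((TFinf_le hψ.continuous h1).trans hE)
    rw [TFfun_eq_ofReal hs hc (TFprofile_nonneg s κ) hsupp]
    exact ENNReal.add_ne_top.2 ⟨ENNReal.ofReal_ne_top, ENNReal.ofReal_ne_top⟩
  · intro η hη
    obtain ⟨ψ, hψ, h0, h1, hk, hE⟩ := happrox η hη
    exact ⟨ψ, hψ, h0, h1, hk, hE.trans (by gcongr)⟩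

/-- The rescaled energy functional, with kinetic coefficient `ε` and coupling `γ`. -/
noncomputable def scaledFun (s : ℝ) (e : ℝ → ℝ) (ε γ : ℝ) (ψ : ℝ → ℝ) : ℝ≥0∞ :=
  ∫⁻ z : ℝ, ENNReal.ofReal (ε * deriv ψ z ^ 2 + |z| ^ s * ψ z ^ 2
    + γ⁻¹ * ψ z ^ 6 * e (γ / ψ z ^ 2))

theorem interaction_le {e : ℝ → ℝ} (he_half : ∀ t : ℝ, 0 < t → t * e (1 / t) ≤ 1 / 2)
    {γ : ℝ} (hγ : 0 < γ) (x : ℝ) : γ⁻¹ * x ^ 6 * e (γ / x ^ 2) ≤ (x ^ 2) ^ 2 / 2 := by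
  rcases eq_or_ne x 0 with rfl | hx
  · simp
  have hx2 : 0 < x ^ 2 := by positivity
  have h := he_half (x ^ 2 / γ) (by positivity)
  rw [one_div_div] at h
  have h2 := mul_le_mul_of_nonneg_left h (sq_nonneg (x ^ 2))
  calc γ⁻¹ * x ^ 6 * e (γ / x ^ 2) = (x ^ 2) ^ 2 * (x ^ 2 / γ * e (γ / x ^ 2)) := by ring
    _ ≤ _ := by linarith

theorem interaction_nonneg {e : ℝ → ℝ} (he_nonneg : ∀ t : ℝ, 0 < t → 0 ≤ e t)
    {γ : ℝ} (hγ : 0 < γ) (x : ℝ) : 0 ≤ γ⁻¹ * x ^ 6 * e (γ / x ^ 2) := by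
  rcases eq_or_ne x 0 with rfl | hx
  · simp
  have := he_nonneg (γ / x ^ 2) (by positivity)
  positivity

theorem le_interaction {e : ℝ → ℝ} (he_nonneg : ∀ t : ℝ, 0 < t → 0 ≤ e t) {c t₀ : ℝ}
    (hc : c ≤ 1) (ht₀ : 0 < t₀) (he : ∀ t, 0 < t → t < t₀ → c / 2 * t ≤ e t)
    {γ : ℝ} (hγ : 0 < γ) (x : ℝ) :
    c * ((x ^ 2) ^ 2 / 2) ≤ γ⁻¹ * x ^ 6 * e (γ / x ^ 2) + γ / (2 * t₀) * x ^ 2 := by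
  rcases eq_or_ne x 0 with rfl | hx
  · simp
  have hx2 : 0 < x ^ 2 := by positivity
  rcases lt_or_ge (γ / x ^ 2) t₀ with h | h
  · have h1 := mul_le_mul_of_nonneg_left (he _ (by positivity) h)
      (by positivity : 0 ≤ γ⁻¹ * x ^ 6)
    have h2 : γ⁻¹ * x ^ 6 * (c / 2 * (γ / x ^ 2)) = c * ((x ^ 2) ^ 2 / 2) := by
      field_simp
    have h3 : 0 ≤ γ / (2 * t₀) * x ^ 2 := by positivity
    linarith
  · have h1 := interaction_nonneg he_nonneg hγ x
    rw [le_div_iff₀ hx2] at h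
    have h2 : x ^ 2 / 2 ≤ γ / (2 * t₀) := by
      rw [div_le_div_iff₀ two_pos (by positivity)]
      linarith
    have h3 := mul_le_mul_of_nonneg_right h2 hx2.le
    have h4 := mul_le_mul_of_nonneg_right hc (by positivity : 0 ≤ (x ^ 2) ^ 2 / 2)
    linarith

theorem scaledFun_le {s : ℝ} {e : ℝ → ℝ}
    (he_half : ∀ t : ℝ, 0 < t → t * e (1 / t) ≤ 1 / 2) {ε γ : ℝ} (hε : 0 ≤ ε) (hγ : 0 < γ)
    (ψ : ℝ → ℝ) :
    scaledFun s e ε γ ψ ≤ ENNReal.ofReal ε * (∫⁻ z, ENNReal.ofReal (deriv ψ z ^ 2))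
      + TFfun s fun z => ψ z ^ 2 := by
  have hm : Measurable fun z => ENNReal.ofReal (deriv ψ z ^ 2) :=
    ((measurable_deriv ψ).pow_const 2).ennreal_ofReal
  unfold scaledFun TFfun
  rw [← lintegral_const_mul _ hm, ← lintegral_add_left (hm.const_mul _)]
  refine lintegral_mono fun z => ?_
  rw [← ENNReal.ofReal_mul hε, ← ENNReal.ofReal_add (by positivity) (by positivity)]
  refine ENNReal.ofReal_le_ofReal ?_
  linarith [interaction_le he_half hγ (ψ z)]

theorem mul_TFfun_le_scaledFun {s : ℝ} {e : ℝ → ℝ} (he_nonneg : ∀ t : ℝ, 0 < t → 0 ≤ e t)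
    {c t₀ : ℝ} (hc0 : 0 ≤ c) (hc : c ≤ 1) (ht₀ : 0 < t₀)
    (he : ∀ t, 0 < t → t < t₀ → c / 2 * t ≤ e t) {ε γ : ℝ} (hε : 0 ≤ ε) (hγ : 0 < γ)
    {ψ : ℝ → ℝ} (hψ : Continuous ψ) (h1 : ∫⁻ z, ENNReal.ofReal (ψ z ^ 2) = 1) :
    ENNReal.ofReal c * TFfun s (fun z => ψ z ^ 2)
      ≤ scaledFun s e ε γ ψ + ENNReal.ofReal (γ / (2 * t₀)) := by
  have hm : Measurable fun z => ENNReal.ofReal (ψ z ^ 2) := (hψ.pow 2).measurable.ennreal_ofReal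
  have hγt : 0 ≤ γ / (2 * t₀) := by positivity
  rw [← mul_one (ENNReal.ofReal (γ / (2 * t₀))), ← h1]
  unfold scaledFun TFfun
  rw [← lintegral_const_mul _ hm, ← lintegral_add_right _ (hm.const_mul _),
    ← lintegral_const_mul' _ _ ENNReal.ofReal_ne_top]
  refine lintegral_mono fun z => ?_
  have hi := interaction_nonneg he_nonneg hγ (ψ z)
  have hp : 0 ≤ |z| ^ s * ψ z ^ 2 := by positivity
  have hk : 0 ≤ ε * deriv ψ z ^ 2 := by positivity
  rw [← ENNReal.ofReal_mul hc0, ← ENNReal.ofReal_mul hγt,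
    ← ENNReal.ofReal_add (by positivity) (by positivity)]
  refine ENNReal.ofReal_le_ofReal ?_
  have := le_interaction he_nonneg hc ht₀ he hγ (ψ z)
  have := mul_le_mul_of_nonneg_right hc hp
  linarith

theorem lintegral_comp_inv_mul (F : ℝ → ℝ≥0∞) {Λ : ℝ} (hΛ : 0 < Λ) :
    ∫⁻ z, F (Λ⁻¹ * z) = ENNReal.ofReal Λ * ∫⁻ z, F z := by
  have hemb : MeasurableEmbedding fun z : ℝ => Λ⁻¹ * z :=
    (Homeomorph.mulLeft₀ Λ⁻¹ (inv_ne_zero hΛ.ne')).measurableEmbedding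
  rw [← hemb.lintegral_map, Real.map_volume_mul_left (inv_ne_zero hΛ.ne'), inv_inv,
    abs_of_pos hΛ, lintegral_smul_measure, smul_eq_mul]

/-- The function `z ↦ √(N/Λ) ψ(z/Λ)`. -/
noncomputable def dilate (N Λ : ℝ) (ψ : ℝ → ℝ) (z : ℝ) : ℝ := √(N / Λ) * ψ (Λ⁻¹ * z)

theorem lintegral_dilate_sq {N Λ : ℝ} (hN : 0 < N) (hΛ : 0 < Λ) (ψ : ℝ → ℝ) :
    ∫⁻ z, ENNReal.ofReal (dilate N Λ ψ z ^ 2)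
      = ENNReal.ofReal N * ∫⁻ z, ENNReal.ofReal (ψ z ^ 2) := by
  have hdiv : 0 ≤ N / Λ := by positivity
  have h : ∀ z, ENNReal.ofReal (dilate N Λ ψ z ^ 2)
      = ENNReal.ofReal (N / Λ) * ENNReal.ofReal (ψ (Λ⁻¹ * z) ^ 2) := fun z => by
    rw [dilate, mul_pow, sq_sqrt hdiv, ENNReal.ofReal_mul hdiv]
  simp only [h]
  rw [lintegral_const_mul' _ _ ENNReal.ofReal_ne_top,
    lintegral_comp_inv_mul (fun z => ENNReal.ofReal (ψ z ^ 2)) hΛ, ← mul_assoc,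
    ← ENNReal.ofReal_mul hdiv, div_mul_cancel₀ _ hΛ.ne']

theorem exists_dilate_eq {N Λ : ℝ} (hN : 0 < N) (hΛ : 0 < Λ) {φ : ℝ → ℝ}
    (hφ : ContDiff ℝ 1 φ) (h0 : ∀ z, 0 ≤ φ z)
    (h1 : ∫⁻ z, ENNReal.ofReal (φ z ^ 2) = ENNReal.ofReal N) :
    ∃ ψ : ℝ → ℝ, ContDiff ℝ 1 ψ ∧ (∀ z, 0 ≤ ψ z) ∧ ∫⁻ z, ENNReal.ofReal (ψ z ^ 2) = 1 ∧
      dilate N Λ ψ = φ := by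
  have ha : 0 < √(N / Λ) := by positivity
  have hd : dilate N Λ (fun z => (√(N / Λ))⁻¹ * φ (Λ * z)) = φ := by
    funext z
    rw [dilate, ← mul_assoc, mul_inv_cancel₀ ha.ne', one_mul, mul_inv_cancel_left₀ hΛ.ne']
  refine ⟨fun z => (√(N / Λ))⁻¹ * φ (Λ * z), ?_, fun z => ?_, ?_, hd⟩
  · exact contDiff_const.mul (hφ.comp (contDiff_const.mul contDiff_id))
  · exact mul_nonneg (inv_nonneg.2 ha.le) (h0 _)
  · have h2 := lintegral_dilate_sq hN hΛ (fun z => (√(N / Λ))⁻¹ * φ (Λ * z))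
    rw [hd, h1] at h2
    have hN' : ENNReal.ofReal N ≠ 0 := (ENNReal.ofReal_pos.2 hN).ne'
    exact ((ENNReal.mul_right_inj hN' ENNReal.ofReal_ne_top).1 ((mul_one _).trans h2)).symm

theorem EEfun_dilate {s : ℝ} (e : ℝ → ℝ) {N L g l : ℝ} (hN : 0 < N)
    (hL : 0 < L) (hg : 0 < g) (hl : 0 < l) (hlam : l ^ s * l = N * g * L) (ψ : ℝ → ℝ) :
    EEfun s e L g (dilate N (L * l) ψ) = ENNReal.ofReal (N / L ^ 2 * l ^ s)
      * scaledFun s e (l ^ s * l ^ 2)⁻¹ (g * L * l / N) ψ := by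
  have hΛ : 0 < L * l := by positivity
  have hls : 0 < l ^ s := by positivity
  have hA : 0 ≤ N / L ^ 2 * l ^ s / (L * l) := by positivity
  set F : ℝ → ℝ≥0∞ := fun z => ENNReal.ofReal ((l ^ s * l ^ 2)⁻¹ * deriv ψ z ^ 2
    + |z| ^ s * ψ z ^ 2 + (g * L * l / N)⁻¹ * ψ z ^ 6 * e (g * L * l / N / ψ z ^ 2)) with hF
  have hpt : ∀ z, ENNReal.ofReal (deriv (dilate N (L * l) ψ) z ^ 2
      + L⁻¹ ^ 2 * |z / L| ^ s * dilate N (L * l) ψ z ^ 2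
      + dilate N (L * l) ψ z ^ 6 * e (g / dilate N (L * l) ψ z ^ 2))
      = ENNReal.ofReal (N / L ^ 2 * l ^ s / (L * l)) * F ((L * l)⁻¹ * z) := by
    intro z
    have hdiv : 0 ≤ N / (L * l) := by positivity
    have hd : deriv (dilate N (L * l) ψ) z
        = √(N / (L * l)) * ((L * l)⁻¹ * deriv ψ ((L * l)⁻¹ * z)) := by
      unfold dilate
      rw [deriv_const_mul_field, deriv_comp_mul_left, smul_eq_mul]
    have hz : |z / L| ^ s = l ^ s * |(L * l)⁻¹ * z| ^ s := by
      rw [← mul_rpow hl.le (abs_nonneg _)]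
      congr 1
      rw [← abs_of_pos hl, ← abs_mul, abs_of_pos hl]
      congr 1
      field_simp
    rw [hd, hz, hF]
    simp only
    rw [← ENNReal.ofReal_mul hA]
    unfold dilate
    generalize deriv ψ ((L * l)⁻¹ * z) = d
    generalize |(L * l)⁻¹ * z| ^ s = v
    generalize ψ ((L * l)⁻¹ * z) = x
    rw [show g / (√(N / (L * l)) * x) ^ 2 = g * L * l / N / x ^ 2 by
      rw [mul_pow, sq_sqrt hdiv]
      field_simp]
    generalize e (g * L * l / N / x ^ 2) = E
    have h6 : (√(N / (L * l)) * x) ^ 6 = (N / (L * l)) ^ 3 * x ^ 6 := by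
      rw [mul_pow, show √(N / (L * l)) ^ 6 = (√(N / (L * l)) ^ 2) ^ 3 by ring, sq_sqrt hdiv]
    have hg' : g = l ^ s * l / (N * L) := by
      field_simp
      linarith
    rw [h6, mul_pow, mul_pow, mul_pow, sq_sqrt hdiv, hg']
    congr 1
    field_simp
  unfold EEfun scaledFun
  simp only [hpt]
  rw [lintegral_const_mul' _ _ ENNReal.ofReal_ne_top, lintegral_comp_inv_mul F hΛ, ← mul_assoc,
    ← ENNReal.ofReal_mul hA, div_mul_cancel₀ _ hΛ.ne']

theorem EEinf_le {s : ℝ} (e : ℝ → ℝ) {N L g l : ℝ} (hN : 0 < N)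
    (hL : 0 < L) (hg : 0 < g) (hl : 0 < l) (hlam : l ^ s * l = N * g * L) {ψ : ℝ → ℝ}
    (hψ : ContDiff ℝ 1 ψ) (h0 : ∀ z, 0 ≤ ψ z) (h1 : ∫⁻ z, ENNReal.ofReal (ψ z ^ 2) = 1) :
    EEinf s e N L g ≤ ENNReal.ofReal (N / L ^ 2 * l ^ s)
      * scaledFun s e (l ^ s * l ^ 2)⁻¹ (g * L * l / N) ψ := by
  refine sInf_le ⟨dilate N (L * l) ψ, ?_, fun z => ?_, ?_, EEfun_dilate e hN hL hg hl hlam ψ⟩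
  · exact contDiff_const.mul (hψ.comp (contDiff_const.mul contDiff_id))
  · exact mul_nonneg (sqrt_nonneg _) (h0 _)
  · rw [lintegral_dilate_sq hN (by positivity), h1, mul_one]

theorem le_EEinf {s : ℝ} (e : ℝ → ℝ) {N L g l : ℝ} (hN : 0 < N)
    (hL : 0 < L) (hg : 0 < g) (hl : 0 < l) (hlam : l ^ s * l = N * g * L) {B : ℝ≥0∞}
    (hB : ∀ ψ : ℝ → ℝ, ContDiff ℝ 1 ψ → ∫⁻ z, ENNReal.ofReal (ψ z ^ 2) = 1 →
      B ≤ scaledFun s e (l ^ s * l ^ 2)⁻¹ (g * L * l / N) ψ) :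
    ENNReal.ofReal (N / L ^ 2 * l ^ s) * B ≤ EEinf s e N L g := by
  refine le_sInf ?_
  rintro _ ⟨φ, hφ, h0, h1, rfl⟩
  obtain ⟨ψ, hψ, -, h1', rfl⟩ := exists_dilate_eq hN (mul_pos hL hl) hφ h0 h1
  rw [EEfun_dilate e hN hL hg hl hlam]
  gcongr
  exact hB ψ hψ h1'

/-- Proposition 2.1: if `N_k → ∞`, `N_k g_k L_k → ∞` but
`g_k L_k (N_k g_k L_k)^{1/(s+1)}/N_k → 0`, then
`[(N_k/L_k²)(N_k g_k L_k)^{s/(s+1)}]⁻¹ E(N_k,L_k,g_k) → E^{TF}(1,1,1)`. -/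
theorem stmt6 (s : ℝ) (hs : 0 < s)
    (e : ℝ → ℝ)
    (he_cont : ContinuousOn e (Set.Ioi 0))
    (he_mono : MonotoneOn e (Set.Ioi 0))
    (he_nonneg : ∀ t : ℝ, 0 < t → 0 ≤ e t)
    (he_half : ∀ t : ℝ, 0 < t → t * e (1 / t) ≤ 1 / 2)
    (he_diff : ∃ δ : ℝ, 0 < δ ∧ ContDiffOn ℝ 1 e (Set.Ioo 0 δ))
    (he_lim : Tendsto (fun t => e t / t) (nhdsWithin 0 (Set.Ioi 0)) (nhds (1 / 2)))
    (he_lim' : Tendsto (deriv e) (nhdsWithin 0 (Set.Ioi 0)) (nhds (1 / 2)))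
    (he_conv : ConvexOn ℝ (Set.Ioi 0) (fun t => t ^ 3 * e (1 / t)))
    (N L g : ℕ → ℝ)
    (hN : ∀ k, 0 < N k) (hL : ∀ k, 0 < L k) (hg : ∀ k, 0 < g k)
    (hNtop : Tendsto N atTop atTop)
    (hNgL : Tendsto (fun k => N k * g k * L k) atTop atTop)
    (hgLbar : Tendsto (fun k =>
        g k * L k * (N k * g k * L k) ^ ((1:ℝ)/(s+1)) / N k) atTop (nhds 0)) :
    Tendsto (fun k =>
        ((N k / (L k) ^ 2) * (N k * g k * L k) ^ (s/(s+1)))⁻¹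
          * EEen s e (N k) (L k) (g k))
      atTop (nhds (ETF111 s)) := by
  obtain ⟨hT, htrial⟩ := TFinf_ne_top_and_exists_contDiff hs
  rw [ETF111_eq]
  set T : ℝ := (TFinf s).toReal with hTdef
  have hT0 : 0 ≤ T := ENNReal.toReal_nonneg
  have hTof : TFinf s = ENNReal.ofReal T := (ENNReal.ofReal_toReal hT).symm
  set l : ℕ → ℝ := fun k => (N k * g k * L k) ^ ((1 : ℝ) / (s + 1)) with hl_def
  have hM : ∀ k, 0 < N k * g k * L k := fun k => mul_pos (mul_pos (hN k) (hg k)) (hL k)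
  have hl : ∀ k, 0 < l k := fun k => rpow_pos_of_pos (hM k) _
  have hls : ∀ k, l k ^ s = (N k * g k * L k) ^ (s / (s + 1)) := fun k => by
    rw [hl_def]
    simp only
    rw [← rpow_mul (hM k).le]
    congr 1
    ring
  have hlam : ∀ k, l k ^ s * l k = N k * g k * L k := fun k => by
    rw [hls, ← rpow_add (hM k), ← add_div, div_self (by positivity), rpow_one]
  have hltop : Tendsto l atTop atTop :=
    (tendsto_rpow_atTop (by positivity : (0 : ℝ) < 1 / (s + 1))).comp hNgL
  set ε : ℕ → ℝ := fun k => (l k ^ s * l k ^ 2)⁻¹ with hε_def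
  have hε : ∀ k, 0 ≤ ε k := fun k => by
    have := hl k
    positivity
  have hεlim : Tendsto ε atTop (nhds 0) := by
    refine tendsto_inv_atTop_zero.comp ((hNgL.atTop_mul_atTop₀ hltop).congr fun k => ?_)
    rw [← hlam k]
    ring
  set γ : ℕ → ℝ := fun k => g k * L k * l k / N k with hγ_def
  have hγ : ∀ k, 0 < γ k := fun k => div_pos (mul_pos (mul_pos (hg k) (hL k)) (hl k)) (hN k)
  have hγlim : Tendsto γ atTop (nhds 0) := hgLbar
  have hA : ∀ k, 0 < N k / L k ^ 2 * l k ^ s := fun k => by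
    have := hl k
    have := hN k
    have := hL k
    positivity
  simp only [← hls]
  have upper : ∀ η : ℝ, 0 < η → ∃ K : ℝ, ∀ k,
      EEinf s e (N k) (L k) (g k)
        ≤ ENNReal.ofReal (N k / L k ^ 2 * l k ^ s * (ε k * K + (T + η))) := by
    intro η hη
    obtain ⟨ψ, hψ, h0, h1, hkin, hE⟩ := htrial η hη
    set K := (∫⁻ z, ENNReal.ofReal (deriv ψ z ^ 2)).toReal with hK
    have hK0 : 0 ≤ K := ENNReal.toReal_nonneg
    refine ⟨K, fun k => (EEinf_le e (hN k) (hL k) (hg k) (hl k) (hlam k) hψ h0 h1).trans ?_⟩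
    have hεk := hε k
    rw [ENNReal.ofReal_mul (hA k).le, ENNReal.ofReal_add (by positivity) (by positivity),
      ENNReal.ofReal_mul hεk, hK, ENNReal.ofReal_toReal hkin, ENNReal.ofReal_add hT0 hη.le,
      ← hTof]
    gcongr
    exact (scaledFun_le he_half hεk (hγ k) ψ).trans (by gcongr)
  have hfin : ∀ k, EEinf s e (N k) (L k) (g k) ≠ ⊤ := fun k => by
    obtain ⟨K, hK⟩ := upper 1 one_pos
    exact ne_top_of_le_ne_top ENNReal.ofReal_ne_top (hK k)
  have lower : ∀ c : ℝ, 0 < c → c < 1 → ∃ C : ℝ, ∀ k,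
      c * T - γ k * C ≤ (N k / L k ^ 2 * l k ^ s)⁻¹ * EEen s e (N k) (L k) (g k) := by
    intro c hc0 hc1
    have hev := he_lim.eventually (lt_mem_nhds (by linarith : c / 2 < 1 / 2))
    obtain ⟨t₀, ht₀, hsub⟩ := mem_nhdsGT_iff_exists_Ioo_subset.1 hev
    have ht₀ : 0 < t₀ := ht₀
    have he : ∀ t, 0 < t → t < t₀ → c / 2 * t ≤ e t := fun t h1 h2 =>
      ((lt_div_iff₀ h1).1 (hsub ⟨h1, h2⟩)).le
    refine ⟨(2 * t₀)⁻¹, fun k => ?_⟩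
    have hγt : 0 ≤ γ k * (2 * t₀)⁻¹ := by
      have := hγ k
      positivity
    have hB := le_EEinf (B := ENNReal.ofReal (c * T - γ k * (2 * t₀)⁻¹)) e (hN k) (hL k) (hg k)
      (hl k) (hlam k) fun ψ hψ h1 => by
        have h2 := mul_TFfun_le_scaledFun (s := s) he_nonneg hc0.le hc1.le ht₀ he (hε k) (hγ k)
          hψ.continuous h1
        have h3 := TFinf_le (s := s) hψ.continuous h1
        rw [ENNReal.ofReal_sub _ hγt, ENNReal.ofReal_mul hc0.le, ← hTof, tsub_le_iff_right]
        refine le_trans (by gcongr) h2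
    rw [← ENNReal.ofReal_mul (hA k).le, ENNReal.ofReal_le_iff_le_toReal (hfin k)] at hB
    rw [← div_eq_inv_mul, le_div_iff₀' (hA k)]
    exact hB
  refine tendsto_order.2 ⟨fun a ha => ?_, fun b hb => ?_⟩
  · have hcont : Tendsto (fun c : ℝ => c * T) (nhdsWithin 1 (Iio 1)) (nhds (1 * T)) :=
      (tendsto_id.mul_const T).mono_left nhdsWithin_le_nhds
    rw [one_mul] at hcont
    have hpos : ∀ᶠ c : ℝ in nhdsWithin 1 (Iio 1), 0 < c :=
      nhdsWithin_le_nhds (lt_mem_nhds one_pos)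
    obtain ⟨c, ⟨hac, hc0⟩, hc1⟩ := ((hcont.eventually (lt_mem_nhds ha)).and hpos |>.and
      self_mem_nhdsWithin).exists
    obtain ⟨C, hC⟩ := lower c hc0 hc1
    have hlim : Tendsto (fun k => c * T - γ k * C) atTop (nhds (c * T - 0 * C)) :=
      tendsto_const_nhds.sub (hγlim.mul_const C)
    rw [zero_mul, sub_zero] at hlim
    filter_upwards [hlim.eventually (lt_mem_nhds hac)] with k hk
    exact hk.trans_le (hC k)
  · obtain ⟨K, hK⟩ := upper ((b - T) / 2) (by linarith)
    have hlim : Tendsto (fun k => ε k * K + (T + (b - T) / 2)) atTop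
        (nhds (0 * K + (T + (b - T) / 2))) := (hεlim.mul_const K).add_const _
    have hlt : 0 * K + (T + (b - T) / 2) < b := by linarith
    have hnn : 0 < 0 * K + (T + (b - T) / 2) := by linarith
    filter_upwards [hlim.eventually (gt_mem_nhds hlt), hlim.eventually (lt_mem_nhds hnn)]
      with k hk hk0
    refine lt_of_le_of_lt ?_ hk
    rw [← div_eq_inv_mul, div_le_iff₀' (hA k)]
    exact ENNReal.toReal_le_of_le_ofReal (mul_pos (hA k) hk0).le (hK k)
end
end

section
/- Fix τ > 0. Let N_k → ∞ and L_k, g_k > 0 be sequences with g_k/γ_k = τ for all k, where γ_k = (N_k/L_k)N_k^{−2/(s+2)}. Then (N_kγ_k²)^{−1} E(N_k, L_k, g_k) → E^{LL}(1,1,τ), where E^{LL}(1,1,τ) = inf{∫_ℝ(|z|^s ρ(z) + ρ(z)³ e(τ/ρ(z)))dz : ρ ≥ 0 measurable, ∫ρ = 1}. -/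
open MeasureTheory Real Filter Set
open scoped ENNReal

noncomputable section

/-- The Lieb–Liniger density-functional energy `E^{LL}(1,1,τ)` (extended real):
the infimum of `∫ (|z|^s ρ + ρ³ e(τ/ρ))` over normalized measurable densities. -/
noncomputable def ELLinf (s : ℝ) (e : ℝ → ℝ) (τ : ℝ) : ℝ≥0∞ :=
  sInf {E : ℝ≥0∞ | ∃ ρ : ℝ → ℝ, Measurable ρ ∧ (∀ z, 0 ≤ ρ z) ∧
    (∫⁻ z : ℝ, ENNReal.ofReal (ρ z)) = 1 ∧
    (∫⁻ z : ℝ, ENNReal.ofReal (|z| ^ s * ρ z + (ρ z)^3 * e (τ / ρ z))) = E}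

/-- The Lieb–Liniger density-functional energy `E^{LL}(1,1,τ)`. -/
noncomputable def ELL11 (s : ℝ) (e : ℝ → ℝ) (τ : ℝ) : ℝ := (ELLinf s e τ).toReal

open scoped Topology

lemma lintegral_eq_mul_lintegral_comp_mul {a : ℝ} (ha : 0 < a) (f : ℝ → ℝ≥0∞) :
    ∫⁻ z, f z = ENNReal.ofReal a * ∫⁻ x, f (a * x) := by
  have hemb : MeasurableEmbedding (fun x : ℝ => a * x) :=
    (Homeomorph.mulLeft₀ a ha.ne').measurableEmbedding
  have h1 := Real.smul_map_volume_mul_left ha.ne'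
  calc ∫⁻ z, f z = ∫⁻ z, f z ∂(ENNReal.ofReal |a| • Measure.map (a * ·) volume) := by rw [h1]
    _ = ENNReal.ofReal a * ∫⁻ x, f (a * x) := by
        rw [lintegral_smul_measure, hemb.lintegral_map, abs_of_pos ha, smul_eq_mul]

lemma continuous_pow_six_mul_comp_div_sq {τ : ℝ} (hτ : 0 < τ) {e : ℝ → ℝ} {C : ℝ}
    (he_cont : ContinuousOn e (Ici 0)) (he_mem : ∀ t : ℝ, 0 ≤ t → e t ∈ Icc 0 C) :
    Continuous fun t : ℝ => t ^ 6 * e (τ / t ^ 2) := by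
  rw [continuous_iff_continuousAt]
  intro t
  rcases eq_or_ne t 0 with rfl | ht
  · have hlim : Tendsto (fun t : ℝ => C * t ^ 6) (𝓝 0) (𝓝 0) := by
      have : Continuous fun t : ℝ => C * t ^ 6 := by fun_prop
      simpa using this.tendsto 0
    have h0 : Tendsto (fun _ : ℝ => (0 : ℝ)) (𝓝 0) (𝓝 0) := tendsto_const_nhds
    have hmain := tendsto_of_tendsto_of_tendsto_of_le_of_le h0 hlim
      (f := fun t : ℝ => t ^ 6 * e (τ / t ^ 2))
      (fun t => mul_nonneg (by positivity) (he_mem _ (by positivity)).1)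
      (fun t => by
        have := (he_mem (τ / t ^ 2) (by positivity)).2
        have h6 : 0 ≤ t ^ 6 := by positivity
        show t ^ 6 * e (τ / t ^ 2) ≤ C * t ^ 6
        nlinarith)
    simpa [ContinuousAt] using hmain
  · have hpos : 0 < τ / t ^ 2 := by positivity
    have he : ContinuousAt e (τ / t ^ 2) := he_cont.continuousAt (Ici_mem_nhds hpos)
    have hdiv : ContinuousAt (fun t : ℝ => τ / t ^ 2) t :=
      continuousAt_const.div (by fun_prop) (by positivity)
    exact (by fun_prop : ContinuousAt (fun t : ℝ => t ^ 6) t).mul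
      (ContinuousAt.comp (f := fun t : ℝ => τ / t ^ 2) he hdiv)

/-- A continuous compactly supported nonnegative function is a pointwise limit of uniformly
bounded `C¹` functions with supports in a common interval. -/
lemma exists_contDiff_one_approx {f : ℝ → ℝ} (hf : Continuous f) (hsupp : HasCompactSupport f)
    (hnonneg : ∀ z, 0 ≤ f z) :
    ∃ (ψ : ℕ → ℝ → ℝ) (M R : ℝ), (∀ n, ContDiff ℝ 1 (ψ n)) ∧ (∀ n x, 0 ≤ ψ n x) ∧
      (∀ n x, ψ n x ≤ M) ∧ (∀ n x, x ∉ Icc (-R) R → ψ n x = 0) ∧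
      ∀ x, Tendsto (fun n => ψ n x) atTop (𝓝 (f x)) := by
  obtain ⟨M, hM⟩ := hsupp.exists_bound_of_continuous hf
  obtain ⟨r, hr⟩ := hsupp.isCompact.isBounded.subset_closedBall 0
  have hzero : ∀ x, r < |x| → f x = 0 := fun x hx => by
    by_contra h
    have := hr (subset_tsupport f h)
    rw [mem_closedBall_zero_iff, Real.norm_eq_abs] at this
    linarith
  set F : ℝ → ℝ := fun x => ∫ t in (0 : ℝ)..x, f t with hF
  have hder : ∀ x, HasDerivAt F (f x) x := fun x => hf.integral_hasStrictDerivAt 0 x |>.hasDerivAt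
  have hF1 : ContDiff ℝ 1 F := by
    rw [contDiff_one_iff_deriv]
    refine ⟨fun x => (hder x).differentiableAt, ?_⟩
    rwa [funext fun x => (hder x).deriv]
  have hdiff : ∀ (x h : ℝ), F (x + h) - F x = ∫ t in x..(x + h), f t := fun x h =>
    intervalIntegral.integral_interval_sub_left (hf.intervalIntegrable _ _)
      (hf.intervalIntegrable _ _)
  set h : ℕ → ℝ := fun n => 1 / ((n : ℝ) + 1) with hh
  have hpos : ∀ n, 0 < h n := fun n => by positivity
  have hle : ∀ n, h n ≤ 1 := fun n => by
    rw [hh]; exact div_le_one_of_le₀ (by linarith [n.cast_nonneg (α := ℝ)]) (by positivity)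
  refine ⟨fun n x => (h n)⁻¹ * (F (x + h n) - F x), M, |r| + 1, ?_, ?_, ?_, ?_, ?_⟩
  · intro n
    exact contDiff_const.mul ((hF1.comp (contDiff_id.add contDiff_const)).sub hF1)
  · intro n x
    simp only [hdiff]
    exact mul_nonneg (inv_nonneg.2 (hpos n).le)
      (intervalIntegral.integral_nonneg (by linarith [hpos n]) fun t _ => hnonneg t)
  · intro n x
    simp only [hdiff]
    rw [inv_mul_le_iff₀ (hpos n)]
    have := intervalIntegral.integral_mono_on (μ := volume) (a := x) (b := x + h n)
      (by linarith [hpos n]) (hf.intervalIntegrable _ _)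
      (continuous_const.intervalIntegrable (μ := volume) _ _)
      (fun t _ => (le_abs_self (f t)).trans (hM t))
    simpa using this
  · intro n x hx
    simp only [hdiff]
    have : ∫ t in x..(x + h n), f t = ∫ t in x..(x + h n), (0 : ℝ) := by
      refine intervalIntegral.integral_congr fun t ht => hzero t ?_
      rw [uIcc_of_le (by linarith [hpos n])] at ht
      have h1 := hle n
      have h2 := le_abs_self r
      rw [mem_Icc, not_and_or, not_le, not_le] at hx
      rcases hx with hx | hx
      · rw [lt_abs]; right; linarith [ht.2]
      · rw [lt_abs]; left; linarith [ht.1]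
    simp [this]
  · intro x
    have h1 := hasDerivAt_iff_tendsto_slope_zero.1 (hder x)
    have h2 : Tendsto h atTop (𝓝[≠] 0) :=
      tendsto_nhdsWithin_iff.2 ⟨tendsto_one_div_add_atTop_nhds_zero_nat,
        Eventually.of_forall fun n => (hpos n).ne'⟩
    exact h1.comp h2

/-- Dominated convergence for integrands `G x (ψ n x)` vanishing where `ψ n` does. -/
lemma tendsto_lintegral_comp_of_bounded_support {G : ℝ → ℝ → ℝ}
    (hG : Continuous (Function.uncurry G)) (hG0 : ∀ x, G x 0 = 0) {ψ : ℕ → ℝ → ℝ} {f : ℝ → ℝ}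
    {M R : ℝ} (hψ : ∀ n, Continuous (ψ n)) (hnonneg : ∀ n x, 0 ≤ ψ n x)
    (hM : ∀ᶠ n in atTop, ∀ x, ψ n x ≤ M) (hR : ∀ n x, x ∉ Icc (-R) R → ψ n x = 0)
    (hlim : ∀ x, Tendsto (fun n => ψ n x) atTop (𝓝 (f x))) :
    Tendsto (fun n => ∫⁻ x, ENNReal.ofReal (G x (ψ n x))) atTop
      (𝓝 (∫⁻ x, ENNReal.ofReal (G x (f x)))) := by
  obtain ⟨B, hB⟩ := ((isCompact_Icc (a := -R) (b := R)).prod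
    (isCompact_Icc (a := (0 : ℝ)) (b := M))).exists_bound_of_continuousOn hG.continuousOn
  refine tendsto_lintegral_filter_of_dominated_convergence
    ((Icc (-R) R).indicator fun _ => ENNReal.ofReal B) ?_ ?_ ?_ ?_
  · refine Eventually.of_forall fun n => ENNReal.measurable_ofReal.comp ?_
    exact (hG.comp (continuous_id.prodMk (hψ n))).measurable
  · filter_upwards [hM] with n hn
    refine Eventually.of_forall fun x => ?_
    by_cases hx : x ∈ Icc (-R) R
    · rw [indicator_of_mem hx]
      exact ENNReal.ofReal_le_ofReal
        ((le_abs_self _).trans (hB (x, ψ n x) ⟨hx, hnonneg n x, hn x⟩))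
    · simp [hR n x hx, hG0]
  · rw [lintegral_indicator measurableSet_Icc, setLIntegral_const]
    exact ENNReal.mul_ne_top ENNReal.ofReal_ne_top (by simp)
  · refine Eventually.of_forall fun x => ?_
    refine (ENNReal.continuous_ofReal.tendsto _).comp ?_
    exact ((hG.comp (continuous_const.prodMk continuous_id)).tendsto (f x)).comp (hlim x)

/-- Normalized `C¹` trial functions with energy below any level above that of `f`. -/
lemma exists_contDiff_one_lintegral_lt {G : ℝ → ℝ → ℝ}
    (hG : Continuous (Function.uncurry G)) (hG0 : ∀ x, G x 0 = 0) {f : ℝ → ℝ}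
    (hf : Continuous f) (hsupp : HasCompactSupport f) (hnonneg : ∀ z, 0 ≤ f z)
    (hmass : ∫⁻ x, ENNReal.ofReal (f x ^ 2) = 1) {A : ℝ≥0∞}
    (hA : ∫⁻ x, ENNReal.ofReal (G x (f x)) < A) :
    ∃ ψ : ℝ → ℝ, ContDiff ℝ 1 ψ ∧ (∀ z, 0 ≤ ψ z) ∧ HasCompactSupport ψ ∧
      ∫⁻ x, ENNReal.ofReal (ψ x ^ 2) = 1 ∧ ∫⁻ x, ENNReal.ofReal (G x (ψ x)) < A := by
  obtain ⟨ψ, M, R, hC, h0, hM, hR, hlim⟩ := exists_contDiff_one_approx hf hsupp hnonneg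
  have hm := tendsto_lintegral_comp_of_bounded_support (G := fun _ t => t ^ 2)
    (by simp only [Function.uncurry_def]; fun_prop) (by simp)
    (fun n => (hC n).continuous) h0 (Eventually.of_forall hM) hR hlim
  simp only [hmass] at hm
  set m : ℕ → ℝ := fun n => (∫⁻ x, ENNReal.ofReal (ψ n x ^ 2)).toReal with hmdef
  have hm1 : Tendsto m atTop (𝓝 1) := by
    have := (ENNReal.tendsto_toReal ENNReal.one_ne_top).comp hm
    rwa [ENNReal.toReal_one] at this
  set c : ℕ → ℝ := fun n => (√(m n))⁻¹ with hc
  have hc1 : Tendsto c atTop (𝓝 1) := by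
    simpa using ((Real.continuous_sqrt.tendsto 1).comp hm1).inv₀ (by simp)
  have hc0 : ∀ n, 0 ≤ c n := fun n => by positivity
  have hE := tendsto_lintegral_comp_of_bounded_support (M := 2 * M) (R := R)
    (ψ := fun n x => c n * ψ n x) (f := f) hG hG0
    (fun n => continuous_const.mul (hC n).continuous) (fun n x => mul_nonneg (hc0 n) (h0 n x))
    (by
      filter_upwards [hc1.eventually (gt_mem_nhds (by norm_num : (1 : ℝ) < 2))] with n hn x
      exact mul_le_mul hn.le (hM n x) (h0 n x) (by norm_num))
    (fun n x hx => by simp [hR n x hx])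
    (fun x => by simpa using hc1.mul (hlim x))
  have hev : ∀ᶠ n in atTop, 0 < m n := hm1.eventually (lt_mem_nhds (by norm_num))
  obtain ⟨n, hn, hnm⟩ := ((hE.eventually (gt_mem_nhds hA)).and hev).exists
  have hmtop : ∫⁻ x, ENNReal.ofReal (ψ n x ^ 2) ≠ ∞ := fun h => by
    simp [hmdef, h] at hnm
  refine ⟨fun x => c n * ψ n x, contDiff_const.mul (hC n), fun x => mul_nonneg (hc0 n) (h0 n x),
    HasCompactSupport.intro (isCompact_Icc (a := -R) (b := R)) fun x hx => by simp [hR n x hx],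
    ?_, hn⟩
  have hcm : c n ^ 2 * m n = 1 := by
    rw [hc]; simp only [inv_pow, Real.sq_sqrt hnm.le]; exact inv_mul_cancel₀ hnm.ne'
  simp only [mul_pow, ENNReal.ofReal_mul (sq_nonneg (c n))]
  rw [lintegral_const_mul' _ _ ENNReal.ofReal_ne_top, ← ENNReal.ofReal_toReal hmtop,
    ← ENNReal.ofReal_mul (sq_nonneg _)]
  simp [hmdef] at hcm ⊢
  exact hcm

lemma potential_scaling {s n l : ℝ} (hs : 0 < s) (hn : 0 < n) (hl : 0 < l) (x : ℝ) :
    l⁻¹ ^ 2 * |n / (n / l * n ^ (-(2 : ℝ) / (s + 2))) * x / l| ^ s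
      = (n / l * n ^ (-(2 : ℝ) / (s + 2))) ^ 2 * |x| ^ s := by
  have h2 : s + 2 ≠ 0 := by positivity
  have e1 : n / (n / l * n ^ (-(2 : ℝ) / (s + 2))) * x / l = n ^ ((2 : ℝ) / (s + 2)) * x := by
    rw [neg_div, rpow_neg hn.le]
    have : 0 < n ^ ((2 : ℝ) / (s + 2)) := rpow_pos_of_pos hn _
    field_simp
  have e2 : (n ^ ((2 : ℝ) / (s + 2))) ^ s = (n * n ^ (-(2 : ℝ) / (s + 2))) ^ 2 := by
    rw [← rpow_mul hn.le, mul_pow, ← rpow_natCast (n ^ (-(2 : ℝ) / (s + 2))) 2, ← rpow_mul hn.le,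
      ← rpow_natCast n 2, ← rpow_add hn]
    congr 1
    field_simp
    push_cast
    ring
  rw [e1, abs_mul, abs_of_pos (rpow_pos_of_pos hn _),
    mul_rpow (rpow_nonneg hn.le _) (abs_nonneg _), e2]
  field_simp

lemma le_EEinf_s7 {s τ n l : ℝ} (hs : 0 < s) (hn : 0 < n) (hl : 0 < l) (e : ℝ → ℝ) :
    ENNReal.ofReal (n * (n / l * n ^ (-(2 : ℝ) / (s + 2))) ^ 2) * ELLinf s e τ
      ≤ EEinf s e n l (τ * (n / l * n ^ (-(2 : ℝ) / (s + 2)))) := by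
  set γ : ℝ := n / l * n ^ (-(2 : ℝ) / (s + 2)) with hγ
  have hγ0 : 0 < γ := by positivity
  refine le_sInf ?_
  rintro _ ⟨φ, hφ, -, hmass, rfl⟩
  have ha : 0 < n / γ := by positivity
  rw [lintegral_eq_mul_lintegral_comp_mul ha] at hmass
  have hle : ELLinf s e τ ≤ ∫⁻ x, ENNReal.ofReal (|x| ^ s * (φ (n / γ * x) ^ 2 / γ)
      + (φ (n / γ * x) ^ 2 / γ) ^ 3 * e (τ / (φ (n / γ * x) ^ 2 / γ))) := by
    refine sInf_le ⟨fun x => φ (n / γ * x) ^ 2 / γ, ?_, fun x => by positivity, ?_, rfl⟩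
    · have := hφ.continuous
      exact Continuous.measurable (by fun_prop)
    · simp only [div_eq_inv_mul (φ _ ^ 2) γ, ENNReal.ofReal_mul (inv_nonneg.2 hγ0.le)]
      have hI := congrArg (fun I => ENNReal.ofReal n⁻¹ * I) hmass
      beta_reduce at hI
      rw [← mul_assoc, ← ENNReal.ofReal_mul (by positivity), ← ENNReal.ofReal_mul (by positivity),
        inv_mul_cancel₀ hn.ne', ENNReal.ofReal_one, ← mul_div_assoc, inv_mul_cancel₀ hn.ne',
        one_div] at hI
      rw [lintegral_const_mul' _ _ ENNReal.ofReal_ne_top, hI]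
  rw [EEfun, lintegral_eq_mul_lintegral_comp_mul ha]
  refine (mul_le_mul_right hle _).trans ?_
  have hc : n * γ ^ 2 = n / γ * γ ^ 3 := by field_simp
  rw [hc, ENNReal.ofReal_mul ha.le, mul_assoc,
    ← lintegral_const_mul' (ENNReal.ofReal (γ ^ 3)) _ ENNReal.ofReal_ne_top]
  gcongr with x
  rw [← ENNReal.ofReal_mul (by positivity)]
  refine ENNReal.ofReal_le_ofReal ?_
  rw [potential_scaling hs hn hl, ← hγ]
  have harg : τ / (φ (n / γ * x) ^ 2 / γ) = τ * γ / φ (n / γ * x) ^ 2 := by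
    rw [div_div_eq_mul_div]
  rw [harg]
  have : γ ^ 3 * (|x| ^ s * (φ (n / γ * x) ^ 2 / γ)
      + (φ (n / γ * x) ^ 2 / γ) ^ 3 * e (τ * γ / φ (n / γ * x) ^ 2))
      = γ ^ 2 * |x| ^ s * φ (n / γ * x) ^ 2
      + φ (n / γ * x) ^ 6 * e (τ * γ / φ (n / γ * x) ^ 2) := by
    field_simp
  rw [this]
  linarith [sq_nonneg (deriv φ (n / γ * x))]

lemma EEinf_le_s7 {s τ n l : ℝ} (hs : 0 < s) (hn : 0 < n) (hl : 0 < l) {e : ℝ → ℝ}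
    (he : ∀ t, 0 ≤ t → 0 ≤ e t) (hτ : 0 < τ) {ψ : ℝ → ℝ} (hψ : ContDiff ℝ 1 ψ)
    (hnonneg : ∀ z, 0 ≤ ψ z) (hmass : ∫⁻ x, ENNReal.ofReal (ψ x ^ 2) = 1) :
    EEinf s e n l (τ * (n / l * n ^ (-(2 : ℝ) / (s + 2)))) ≤
      ENNReal.ofReal (n * (n / l * n ^ (-(2 : ℝ) / (s + 2))) ^ 2) *
        (ENNReal.ofReal (n⁻¹ ^ 2) * (∫⁻ x, ENNReal.ofReal (deriv ψ x ^ 2)) +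
          ∫⁻ x, ENNReal.ofReal (|x| ^ s * ψ x ^ 2 + ψ x ^ 6 * e (τ / ψ x ^ 2))) := by
  set γ : ℝ := n / l * n ^ (-(2 : ℝ) / (s + 2)) with hγ
  have hγ0 : 0 < γ := by positivity
  have ha : 0 < n / γ := by positivity
  have hmul : ∀ x, (n / γ)⁻¹ * (n / γ * x) = x := fun x => inv_mul_cancel_left₀ ha.ne' x
  have hsq : √γ ^ 2 = γ := Real.sq_sqrt hγ0.le
  have hsix : √γ ^ 6 = γ ^ 3 := by rw [← hsq]; ring_nf; simp [hsq]
  have hmeas : Measurable fun x => ENNReal.ofReal (deriv ψ x ^ 2) :=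
    ENNReal.measurable_ofReal.comp ((hψ.continuous_deriv le_rfl).measurable.pow_const 2)
  have hφ : ContDiff ℝ 1 fun z => √γ * ψ ((n / γ)⁻¹ * z) :=
    contDiff_const.mul (hψ.comp (contDiff_const.mul contDiff_id))
  refine le_trans (b := EEfun s e l (τ * γ) fun z => √γ * ψ ((n / γ)⁻¹ * z))
    (sInf_le ⟨_, hφ, fun z => mul_nonneg (by positivity) (hnonneg _), ?_, rfl⟩) ?_
  · rw [lintegral_eq_mul_lintegral_comp_mul ha]
    simp only [hmul, mul_pow, hsq, ENNReal.ofReal_mul hγ0.le]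
    rw [lintegral_const_mul' _ _ ENNReal.ofReal_ne_top, hmass, mul_one,
      ← ENNReal.ofReal_mul ha.le, div_mul_cancel₀ _ hγ0.ne']
  · have hderiv : ∀ x, deriv (fun z => √γ * ψ ((n / γ)⁻¹ * z)) (n / γ * x)
        = √γ * ((n / γ)⁻¹ * deriv ψ x) := fun x => by
      rw [deriv_const_mul_field, deriv_comp_mul_left, hmul, smul_eq_mul]
    have hc : n * γ ^ 2 = n / γ * γ ^ 3 := by field_simp
    rw [EEfun, lintegral_eq_mul_lintegral_comp_mul ha, hc, ENNReal.ofReal_mul ha.le, mul_assoc,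
      ← lintegral_const_mul' (ENNReal.ofReal (n⁻¹ ^ 2)) _ ENNReal.ofReal_ne_top,
      ← lintegral_add_left (hmeas.const_mul _),
      ← lintegral_const_mul' (ENNReal.ofReal (γ ^ 3)) _ ENNReal.ofReal_ne_top]
    gcongr with x
    rw [← ENNReal.ofReal_mul (by positivity), ← ENNReal.ofReal_add (by positivity)
      (add_nonneg (by positivity) (mul_nonneg (by positivity) (he _ (by positivity)))),
      ← ENNReal.ofReal_mul (by positivity)]
    refine ENNReal.ofReal_le_ofReal (le_of_eq ?_)
    rw [potential_scaling hs hn hl, ← hγ, hderiv, hmul]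
    simp only [mul_pow, hsq, hsix]
    rw [mul_comm τ γ, mul_div_mul_left _ _ hγ0.ne']
    field_simp
    ring

lemma lintegral_ofReal_ne_top_of_hasCompactSupport {h : ℝ → ℝ} (hh : Continuous h)
    (hs : HasCompactSupport h) : ∫⁻ x, ENNReal.ofReal (h x) ≠ ∞ :=
  (hh.integrable_of_hasCompactSupport hs).lintegral_lt_top.ne

/-- Proposition 2.2: if `N_k → ∞` with `g_k/γ_k = τ` fixed, where
`γ_k = (N_k/L_k)N_k^{−2/(s+2)}`, then `(N_kγ_k²)⁻¹E(N_k,L_k,g_k) → E^{LL}(1,1,τ)`. -/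
theorem stmt7 (τ : ℝ) (hτ : 0 < τ) (s : ℝ) (hs : 0 < s)
    (e : ℝ → ℝ)
    (he_cont : ContinuousOn e (Set.Ici 0))
    (he_mono : MonotoneOn e (Set.Ici 0))
    (he_zero : e 0 = 0)
    (he_mem : ∀ t : ℝ, 0 ≤ t → e t ∈ Set.Icc 0 (Real.pi ^ 2 / 3))
    (he_conv : ConvexOn ℝ (Set.Ioi 0) (fun t => t ^ 3 * e (1 / t)))
    -- the limiting LL functional possesses a bounded continuous compactly
    -- supported minimizer
    (ρLL : ℝ → ℝ) (hρ_cont : Continuous ρLL) (hρ_supp : HasCompactSupport ρLL)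
    (hρ_nonneg : ∀ z, 0 ≤ ρLL z)
    (hρ_mass : (∫⁻ z : ℝ, ENNReal.ofReal (ρLL z)) = 1)
    (hρ_min : (∫⁻ z : ℝ, ENNReal.ofReal
        (|z| ^ s * ρLL z + (ρLL z)^3 * e (τ / ρLL z))) = ELLinf s e τ)
    (N : ℕ → ℕ) (L g : ℕ → ℝ)
    (hL : ∀ k, 0 < L k) (hg : ∀ k, 0 < g k)
    (hN : Tendsto (fun k => (N k : ℝ)) atTop atTop)
    (hgγ : ∀ k, g k = τ * ((N k : ℝ) / L k * (N k : ℝ) ^ (-(2:ℝ)/(s+2)))) :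
    Tendsto (fun k =>
        ((N k : ℝ) * ((N k : ℝ) / L k * (N k : ℝ) ^ (-(2:ℝ)/(s+2))) ^ 2)⁻¹
          * EEen s e (N k) (L k) (g k))
      atTop (nhds (ELL11 s e τ)) := by
  have he0 : ∀ t, 0 ≤ t → 0 ≤ e t := fun t ht => (he_mem t ht).1
  set G : ℝ → ℝ → ℝ := fun x t => |x| ^ s * t ^ 2 + t ^ 6 * e (τ / t ^ 2) with hGdef
  have hG : Continuous (Function.uncurry G) := by
    have hW := continuous_pow_six_mul_comp_div_sq hτ he_cont he_mem
    have h1 : Continuous fun p : ℝ × ℝ => |p.1| ^ s :=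
      (continuous_abs.comp continuous_fst).rpow_const fun _ => Or.inr hs.le
    exact (h1.mul (continuous_snd.pow 2)).add (hW.comp continuous_snd)
  set f : ℝ → ℝ := fun x => √(ρLL x) with hfdef
  have hf2 : ∀ x, f x ^ 2 = ρLL x := fun x => Real.sq_sqrt (hρ_nonneg x)
  have hf6 : ∀ x, f x ^ 6 = ρLL x ^ 3 := fun x => by rw [← hf2]; ring
  have hf_supp : HasCompactSupport f := hρ_supp.comp_left Real.sqrt_zero
  have hf_mass : ∫⁻ x, ENNReal.ofReal (f x ^ 2) = 1 := by simpa only [hf2] using hρ_mass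
  have hf_min : ∫⁻ x, ENNReal.ofReal (G x (f x)) = ELLinf s e τ := by
    simpa only [hGdef, hf2, hf6] using hρ_min
  have hf_cont : Continuous f := hρ_cont.sqrt
  have hfin : ELLinf s e τ ≠ ∞ := by
    rw [← hf_min]
    have hcs : HasCompactSupport fun x => G x (f x) :=
      hf_supp.mono fun x hx h => hx (by simp [hGdef, h])
    exact lintegral_ofReal_ne_top_of_hasCompactSupport
      (hG.comp (continuous_id.prodMk hf_cont)) hcs
  have hNpos : ∀ᶠ k in atTop, 0 < (N k : ℝ) := hN.eventually_gt_atTop 0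
  have hcpos : ∀ k, 0 < (N k : ℝ) →
      0 < (N k : ℝ) * ((N k : ℝ) / L k * (N k : ℝ) ^ (-(2 : ℝ) / (s + 2))) ^ 2 := fun k hk => by
    have := hL k
    positivity
  have hupper : ∀ b, ELL11 s e τ < b → ∀ᶠ k in atTop, EEinf s e (N k) (L k) (g k) <
      ENNReal.ofReal
        ((N k : ℝ) * ((N k : ℝ) / L k * (N k : ℝ) ^ (-(2 : ℝ) / (s + 2))) ^ 2 * b) := by
    intro b hb
    have hA : ∫⁻ x, ENNReal.ofReal (G x (f x)) < ENNReal.ofReal b := by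
      rw [hf_min]
      exact (ENNReal.lt_ofReal_iff_toReal_lt hfin).2 hb
    obtain ⟨ψ, hψ, hψ0, hψs, hψm, hψE⟩ := exists_contDiff_one_lintegral_lt hG
      (fun x => by simp [hGdef]) hf_cont hf_supp (fun x => Real.sqrt_nonneg _) hf_mass hA
    have hK : ∫⁻ x, ENNReal.ofReal (deriv ψ x ^ 2) ≠ ∞ :=
      lintegral_ofReal_ne_top_of_hasCompactSupport ((hψ.continuous_deriv le_rfl).pow 2)
        (hψs.deriv.mono fun x hx h => hx (by simp [h]))
    have hinv : Tendsto (fun k => ENNReal.ofReal ((N k : ℝ)⁻¹ ^ 2)) atTop (𝓝 0) := by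
      simpa using ENNReal.tendsto_ofReal ((tendsto_inv_atTop_zero.comp hN).pow 2)
    have hlim := (ENNReal.Tendsto.mul_const hinv (Or.inr hK)).add_const
      (∫⁻ x, ENNReal.ofReal (G x (ψ x)))
    rw [zero_mul, zero_add] at hlim
    filter_upwards [hNpos, hlim.eventually (gt_mem_nhds hψE)] with k hk hlt
    rw [hgγ k, ENNReal.ofReal_mul (hcpos k hk).le]
    exact (EEinf_le_s7 hs hk (hL k) he0 hτ hψ hψ0 hψm).trans_lt
      (ENNReal.mul_lt_mul_right (ENNReal.ofReal_pos.2 (hcpos k hk)).ne' ENNReal.ofReal_ne_top hlt)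
  rw [tendsto_order]
  constructor
  · intro a ha
    filter_upwards [hNpos, hupper _ (lt_add_one _)] with k hk hlt
    have hle := le_EEinf_s7 (τ := τ) hs hk (hL k) e
    rw [← hgγ k] at hle
    have := ENNReal.toReal_mono hlt.ne_top hle
    rw [ENNReal.toReal_mul, ENNReal.toReal_ofReal (hcpos k hk).le] at this
    exact ha.trans_le ((le_inv_mul_iff₀ (hcpos k hk)).2 this)
  · intro b hb
    filter_upwards [hNpos, hupper b hb] with k hk hlt
    exact (inv_mul_lt_iff₀ (hcpos k hk)).2 (ENNReal.toReal_lt_of_lt_ofReal hlt)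
end
end
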